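/- arXiv:1703.01993 — 2 statements merged into one kernel-verified Lean document; each statement's English description precedes it below -/
import Mathlib

section
/- Let s̄ be a primitive binary necklace of length l whose strings contain at least one '1'. If s̄ has odd weight, then l = k_Z(c), where c is the unique class of primitive indefinite forms with σ̄(c) = s̄ and k_Z(c) denotes the number of Z-reduced forms in c. If s̄ has even weight and c₁, c₂ are the two primitive classes whose images under σ̄ are represented by strings of s̄, then l = k_Z(c₁) + k_Z(c₂). -/
/-- A binary quadratic form `A x² + B x y + C y²` with integer coefficients. -/
structure QF where
  a : ℤ
  b : ℤ
  c : ℤ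

/-- The discriminant `B² - 4AC` of a form. -/
def QF.disc (f : QF) : ℤ := f.b ^ 2 - 4 * f.a * f.c

/-- The action of a matrix `[[α, β], [γ, δ]]` on a form:
`f(x,y) ↦ f(αx + βy, γx + δy)`. -/
def QF.transform (f : QF) (α β γ δ : ℤ) : QF :=
  ⟨f.a * α ^ 2 + f.b * α * γ + f.c * γ ^ 2,
   2 * f.a * α * β + f.b * (α * δ + β * γ) + 2 * f.c * γ * δ,
   f.a * β ^ 2 + f.b * β * δ + f.c * δ ^ 2⟩

/-- A form is indefinite if its discriminant is positive and not a perfect square. -/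
def QF.IsIndefinite (f : QF) : Prop := 0 < f.disc ∧ ¬ IsSquare f.disc

/-- An indefinite form `(A,B,C)` is Z-reduced if `A,B,C > 0` and `B > A + C`. -/
def QF.IsZReduced (f : QF) : Prop :=
  f.IsIndefinite ∧ 0 < f.a ∧ 0 < f.b ∧ 0 < f.c ∧ f.a + f.c < f.b

/-- An indefinite form `(A,B,C)` is G-reduced if `AC < 0` and `B > |A + C|`. -/
def QF.IsGReduced (f : QF) : Prop :=
  f.IsIndefinite ∧ f.a * f.c < 0 ∧ |f.a + f.c| < f.b

/-- G-reduced with `A > 0`. -/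
def QF.IsGPlus (f : QF) : Prop := f.IsGReduced ∧ 0 < f.a

/-- G-reduced with `A < 0`. -/
def QF.IsGMinus (f : QF) : Prop := f.IsGReduced ∧ f.a < 0

/-- `(t, u)` is the fundamental solution of `|t² - Δ u²| = 4`:
a solution in positive integers with `u` minimal. -/
def IsFundSol (Δ t u : ℤ) : Prop :=
  0 < t ∧ 0 < u ∧ |t ^ 2 - Δ * u ^ 2| = 4 ∧
    ∀ t' u' : ℤ, 0 < t' → 0 < u' → |t' ^ 2 - Δ * u' ^ 2| = 4 → u ≤ u'

/-- The continuant of a finite sequence of integers. -/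
def cont : List ℤ → ℤ
  | [] => 1
  | [q] => q
  | q :: r :: t => q * cont (r :: t) + cont t

/-- `L` is the list of partial quotients of a regular continued fraction expansion of
the rational number `x`: all partial quotients are positive and the value of the
continued fraction, namely `cont L / cont L.tail`, equals `x`. -/
def IsCF (x : ℚ) (L : List ℤ) : Prop :=
  L ≠ [] ∧ (∀ q ∈ L, 0 < q) ∧ (cont L : ℚ) = x * cont L.tail

/-- The bead sequence `β(f)` of a Z-reduced form `f = (A,B,C)` of discriminant `Δ`:
with `(t,u)` the fundamental solution of `|t² - Δu²| = 4` and `z = (t + Bu)/2`,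
it is the continued fraction expansion of `z/(z - Au)` whose number of partial
quotients is even if `t² - Δu² = -4` and odd otherwise. -/
def QF.IsBeta (f : QF) (L : List ℤ) : Prop :=
  ∃ t u : ℤ, IsFundSol f.disc t u ∧
    IsCF ((((t + f.b * u : ℤ) : ℚ) / 2) / ((((t + f.b * u : ℤ) : ℚ) / 2) - ((f.a * u : ℤ) : ℚ))) L ∧
    (t ^ 2 - f.disc * u ^ 2 = -4 → Even L.length) ∧
    (t ^ 2 - f.disc * u ^ 2 = 4 → Odd L.length)

/-- Dirichlet's map `γ(f)` for `f = (A,B,C)` in `G⁺` of discriminant `Δ`: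
with `(t,u)` the fundamental solution of `|t² - Δu²| = 4` and `z = (t + Bu)/2`,
it is the continued fraction expansion of `z/(Au)` whose number of partial
quotients is odd if `t² - Δu² = -4` and even otherwise. -/
def QF.IsGamma (f : QF) (L : List ℤ) : Prop :=
  ∃ t u : ℤ, IsFundSol f.disc t u ∧
    IsCF ((((t + f.b * u : ℤ) : ℚ) / 2) / ((f.a * u : ℤ) : ℚ)) L ∧
    (t ^ 2 - f.disc * u ^ 2 = -4 → Odd L.length) ∧
    (t ^ 2 - f.disc * u ^ 2 = 4 → Even L.length)

/-- The stars-and-bars map: `(q₁, …, q_l)` is sent to the binary string of length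
`q₁ + ⋯ + q_l - 1` whose `j`-th character is `1` exactly at the partial sums
`q₁, q₁ + q₂, …, q₁ + ⋯ + q_{l-1}`. -/
def sb : List ℤ → List Bool
  | [] => []
  | [q] => List.replicate (q - 1).toNat false
  | q :: r :: t => List.replicate (q - 1).toNat false ++ true :: sb (r :: t)

/-- `σ(f) = sb(β(f))`. -/
def QF.IsSigma (f : QF) (s : List Bool) : Prop :=
  ∃ L : List ℤ, f.IsBeta L ∧ s = sb L

/-- Zagier's reduction operator: `f ↦ f(nx + y, -x)` with `n = ⌈(B + √Δ)/(2A)⌉`. -/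
noncomputable def RZ (f : QF) : QF :=
  f.transform ⌈((f.b : ℝ) + Real.sqrt (f.disc : ℝ)) / (2 * (f.a : ℝ))⌉ 1 (-1) 0

/-- The number `δ` in Gauss's reduction operator: `|δ| = ⌊(B + √Δ)/(2|A|)⌋` with
`δ` having the sign of `A`. -/
noncomputable def gaussDelta (f : QF) : ℤ :=
  f.a.sign * ⌊((f.b : ℝ) + Real.sqrt (f.disc : ℝ)) / (2 * |(f.a : ℝ)|)⌋

/-- Gauss's reduction operator: `f ↦ f(δx + y, -x)`. -/
noncomputable def RG (f : QF) : QF := f.transform (gaussDelta f) 1 (-1) 0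

/-- Add `1` to the last entry of a list. -/
def addLast : List ℤ → List ℤ
  | [] => []
  | [q] => [q + 1]
  | q :: r :: t => q :: addLast (r :: t)

/-- Subtract `1` from the last entry of a list. -/
def subLast : List ℤ → List ℤ
  | [] => []
  | [q] => [q - 1]
  | q :: r :: t => q :: subLast (r :: t)

/-- Subtract `1` from the first entry of a list. -/
def decHead : List ℤ → List ℤ
  | [] => []
  | q :: t => (q - 1) :: t

/-- The operator `T_Z`: `(q₁,…,q_l) ↦ (q₁-1, q₂, …, q_{l-1}, q_l+1)` if `q₁ ≥ 2`;
`(q₂, q₁)` if `q₁ = 1` and `l = 2`; `(q₃, …, q_l, q₂, q₁)` if `q₁ = 1` and `l > 2`. -/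
def TZ : List ℤ → List ℤ
  | [] => []
  | [q] => [q]
  | q :: r :: s => if q = 1 then s ++ [r, 1] else (q - 1) :: addLast (r :: s)

/-- The map `μ` from G-reduced forms to Z-reduced forms. -/
def mu (f : QF) : QF :=
  if 0 < f.a then ⟨f.a, 2 * f.a + f.b, f.a + f.b + f.c⟩
  else ⟨f.a + f.b + f.c, f.b + 2 * f.c, f.c⟩

/-- The section `τ` of `β`: `τ((q₁,…,q_l)) = (A,B,C)` with `A = [q₁-1, q₂, …, q_l]`,
`C = [q₁, …, q_{l-1}, q_l - 1]`, `B = [q₁,…,q_l] + [q₁-1, q₂, …, q_{l-1}, q_l-1]`. -/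
def tau (L : List ℤ) : QF :=
  ⟨cont (decHead L), cont L + cont (subLast (decHead L)), cont (subLast L)⟩

/-- Multiply all coefficients of a form by `u`. -/
def QF.smul (u : ℤ) (f : QF) : QF := ⟨u * f.a, u * f.b, u * f.c⟩

/-- The reversal `(A,B,C)^R = (C,B,A)`. -/
def QF.rev (f : QF) : QF := ⟨f.c, f.b, f.a⟩

/-- The map `ρ((A,B,C)) = (-A, B, -C)`. -/
def rho (f : QF) : QF := ⟨-f.a, f.b, -f.c⟩

/-- A form is primitive if its coefficients have gcd 1. -/
def IsPrimitiveForm (f : QF) : Prop := Int.gcd f.a (Int.gcd f.b f.c) = 1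

/-- `SL₂(ℤ)`-equivalence of forms. -/
def FormEquiv (f g : QF) : Prop :=
  ∃ α β γ δ : ℤ, α * δ - β * γ = 1 ∧ g = f.transform α β γ δ

/-- A nonempty string is primitive if it differs from all of its nontrivial cyclic
shifts. -/
def PrimitiveList {α : Type*} (l : List α) : Prop :=
  l ≠ [] ∧ ∀ n, 0 < n → n < l.length → l.rotate n ≠ l

/-- The continuant `[q₂, …, q_{l-1}]` of the interior of a list, with the convention
that it is `0` for a list of length `≤ 1`. -/
def innerCont (L : List ℤ) : ℤ := if L.length ≤ 1 then 0 else cont (L.tail.dropLast)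

/-- The section `ξ` of `γ`: `ξ((q₁,…,q_l)) = (A,B,C)` with `A = [q₂,…,q_l]`,
`B = [q₁,…,q_l] - [q₂,…,q_{l-1}]`, `C = -[q₁,…,q_{l-1}]`. -/
def xiForm (L : List ℤ) : QF := ⟨cont L.tail, cont L - innerCont L, -(cont L.dropLast)⟩

/-- `p` is the minimal period of the purely periodic sequence `d`. -/
def IsMinPeriod {α : Type*} [Inhabited α] (d : ℕ → α) (p : List α) : Prop :=
  p ≠ [] ∧ (∀ n, d n = p.getD (n % p.length) default) ∧
    ∀ m, 0 < m → (∀ n, d (n + m) = d n) → p.length ≤ m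

/-- `d` is the sequence of partial quotients of the Denjoy continued fraction of `x`
(`true` = quotient 1, `false` = quotient 0): `ξ₀ = x`, `qₙ = 0` if `ξ_{n-1} < 1`,
`qₙ = 1` if `ξ_{n-1} > 1`, and `ξₙ = 1/(ξ_{n-1} - qₙ)`. -/
def IsDenjoySeq (x : ℝ) (d : ℕ → Bool) : Prop :=
  ∃ ξ : ℕ → ℝ, ξ 0 = x ∧
    ∀ n, ((ξ n < 1 ∧ d n = false) ∨ (1 < ξ n ∧ d n = true)) ∧
      ξ (n + 1) = 1 / (ξ n - if d n then 1 else 0)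

/-- `a` is the sequence of partial quotients of the regular continued fraction of `x`. -/
def IsRegCFSeq (x : ℝ) (a : ℕ → ℤ) : Prop :=
  ∃ ξ : ℕ → ℝ, ξ 0 = x ∧ ∀ n, a n = ⌊ξ n⌋ ∧ ξ (n + 1) = 1 / (ξ n - (a n : ℝ))

/-- Regular-to-Denjoy conversion: each partial quotient `q` becomes the string
`1 0 1 0 ⋯ 0 1` of `q` ones alternating with `q - 1` zeroes. -/
def regToDen (L : List ℤ) : List Bool :=
  (L.map fun q => true :: (List.replicate (q - 1).toNat [false, true]).flatten).flatten

/-- Replace each character `0` by the two characters `01`. -/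
def expand01 (s : List Bool) : List Bool :=
  (s.map fun b => if b then [true] else [false, true]).flatten

/-- A quadratic irrational. -/
def IsQuadIrrational (x : ℝ) : Prop :=
  Irrational x ∧ ∃ a b c : ℤ, a ≠ 0 ∧ (a : ℝ) * x ^ 2 + (b : ℝ) * x + (c : ℝ) = 0


/-! ### River forms -/

namespace ZCal

theorem qf_ext {f g : QF} (ha : f.a = g.a) (hb : f.b = g.b) (hc : f.c = g.c) : f = g := by
  cases f; cases g; simp_all

/-- Indefinite forms negative at `(1,0)` and positive at `(0,1)`. -/
def River (g : QF) : Prop := g.IsIndefinite ∧ g.a < 0 ∧ 0 < g.c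

/-- Value at `(1,1)`. -/
def v (g : QF) : ℤ := g.a + g.b + g.c

/-- One step along the river. -/
def nxt (g : QF) : QF :=
  if 0 < v g then ⟨g.a, 2 * g.a + g.b, g.a + g.b + g.c⟩
  else ⟨g.a + g.b + g.c, g.b + 2 * g.c, g.c⟩

theorem nxt_pos {g : QF} (h : 0 < v g) : nxt g = ⟨g.a, 2 * g.a + g.b, g.a + g.b + g.c⟩ := by
  simp [nxt, h]

theorem nxt_neg {g : QF} (h : ¬ 0 < v g) : nxt g = ⟨g.a + g.b + g.c, g.b + 2 * g.c, g.c⟩ := by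
  simp [nxt, h]

/-- The swap with change of sign. -/
def flip (g : QF) : QF := ⟨-g.c, -g.b, -g.a⟩

theorem flip_flip (g : QF) : flip (flip g) = g := by
  apply qf_ext <;> simp [flip]

theorem v_flip (g : QF) : v (flip g) = - v g := by simp only [v, flip]; ring

theorem River.v_ne {g : QF} (h : River g) : v g ≠ 0 := by
  intro h0
  apply h.1.2
  refine ⟨g.a - g.c, ?_⟩
  have : g.b = -g.a - g.c := by unfold v at h0; linarith
  unfold QF.disc; rw [this]; ring

theorem disc_nxt (g : QF) : (nxt g).disc = g.disc := by
  unfold nxt QF.disc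
  split_ifs <;> simp only <;> ring

theorem River.nxt {g : QF} (h : River g) : River (nxt g) := by
  have hv := h.v_ne
  refine ⟨?_, ?_⟩
  · have := h.1
    unfold QF.IsIndefinite at *
    rwa [disc_nxt]
  · by_cases h0 : 0 < v g
    · rw [nxt_pos h0]; exact ⟨h.2.1, h0⟩
    · rw [nxt_neg h0]; exact ⟨lt_of_le_of_ne (not_lt.1 h0) hv, h.2.2⟩

theorem River.iter {g : QF} (h : River g) (n : ℕ) : River (ZCal.nxt^[n] g) := by
  induction n with
  | zero => exact h
  | succ n ih => rw [Function.iterate_succ_apply']; exact ih.nxt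

theorem nxt_flip {g : QF} (h : River g) : nxt (flip g) = flip (nxt g) := by
  have hv := h.v_ne
  by_cases h0 : 0 < v g
  · have h1 : ¬ 0 < v (flip g) := by rw [v_flip]; omega
    rw [nxt_pos h0, nxt_neg h1]
    apply qf_ext <;> simp only [flip] <;> ring
  · have h1 : 0 < v (flip g) := by rw [v_flip]; omega
    rw [nxt_neg h0, nxt_pos h1]
    apply qf_ext <;> simp only [flip] <;> ring

theorem nxt_inj {g h : QF} (hg : River g) (hh : River h) (e : nxt g = nxt h) : g = h := by
  obtain ⟨_, hg1, hg2⟩ := hg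
  obtain ⟨_, hh1, hh2⟩ := hh
  by_cases h0 : 0 < v g <;> by_cases h1 : 0 < v h
  · rw [nxt_pos h0, nxt_pos h1] at e
    simp only [QF.mk.injEq] at e
    apply qf_ext <;> linarith [e.1, e.2.1, e.2.2]
  · rw [nxt_pos h0, nxt_neg h1] at e
    simp only [QF.mk.injEq] at e
    unfold v at *
    linarith [e.1, e.2.1, e.2.2]
  · rw [nxt_neg h0, nxt_pos h1] at e
    simp only [QF.mk.injEq] at e
    unfold v at *
    linarith [e.1, e.2.1, e.2.2]
  · rw [nxt_neg h0, nxt_neg h1] at e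
    simp only [QF.mk.injEq] at e
    apply qf_ext <;> linarith [e.1, e.2.1, e.2.2]

theorem iter_inj (n : ℕ) {g h : QF} (hg : River g) (hh : River h)
    (e : nxt^[n] g = nxt^[n] h) : g = h := by
  induction n with
  | zero => exact e
  | succ n ih =>
    rw [Function.iterate_succ_apply', Function.iterate_succ_apply'] at e
    exact ih (nxt_inj (hg.iter n) (hh.iter n) e)

/-! ### Equivalence -/

theorem fe_refl (f : QF) : FormEquiv f f :=
  ⟨1, 0, 0, 1, by norm_num, by apply qf_ext <;> simp [QF.transform]⟩

theorem transform_transform (f : QF) (a b c d a' b' c' d' : ℤ) :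
    (f.transform a b c d).transform a' b' c' d' =
      f.transform (a * a' + b * c') (a * b' + b * d') (c * a' + d * c') (c * b' + d * d') := by
  apply qf_ext <;> simp only [QF.transform] <;> ring

theorem transform_one (f : QF) : f.transform 1 0 0 1 = f := by
  apply qf_ext <;> simp [QF.transform]

theorem fe_trans {f g h : QF} (h1 : FormEquiv f g) (h2 : FormEquiv g h) : FormEquiv f h := by
  obtain ⟨a, b, c, d, e, rfl⟩ := h1
  obtain ⟨a', b', c', d', e', rfl⟩ := h2
  refine ⟨_, _, _, _, ?_, transform_transform _ _ _ _ _ _ _ _ _⟩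
  linear_combination (a' * d' - b' * c') * e + e'

theorem fe_inv (f : QF) {a b c d : ℤ} (e : a * d - b * c = 1) :
    (f.transform a b c d).transform d (-b) (-c) a = f := by
  rw [transform_transform]
  have h1 : a * d + b * -c = 1 := by linarith
  have h2 : a * -b + b * a = 0 := by ring
  have h3 : c * d + d * -c = 0 := by ring
  have h4 : c * -b + d * a = 1 := by linarith
  rw [h1, h2, h3, h4, transform_one]

theorem fe_symm {f g : QF} (h : FormEquiv f g) : FormEquiv g f := by
  obtain ⟨a, b, c, d, e, rfl⟩ := h
  exact ⟨d, -b, -c, a, by linarith, (fe_inv f e).symm⟩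

theorem fe_nxt (g : QF) : FormEquiv g (nxt g) := by
  by_cases h : 0 < v g
  · rw [nxt_pos h]
    exact ⟨1, 1, 0, 1, by norm_num, by apply qf_ext <;> simp only [QF.transform] <;> ring⟩
  · rw [nxt_neg h]
    exact ⟨1, 0, 1, 1, by norm_num, by apply qf_ext <;> simp only [QF.transform] <;> ring⟩

theorem fe_iter (g : QF) (n : ℕ) : FormEquiv g (nxt^[n] g) := by
  induction n with
  | zero => exact fe_refl g
  | succ n ih => rw [Function.iterate_succ_apply']; exact fe_trans ih (fe_nxt _)

theorem orbit_nonneg (N : ℕ) : ∀ (g : QF) (α β γ δ : ℤ), River g → 0 < α → 0 ≤ β → 0 ≤ γ →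
    0 < δ → α * δ - β * γ = 1 → (g.transform α β γ δ).a < 0 → 0 < (g.transform α β γ δ).c →
    (α + β + γ + δ).toNat ≤ N → ∃ n, nxt^[n] g = g.transform α β γ δ := by
  induction N with
  | zero => intro g α β γ δ _ _ _ _ _ _ _ _ h; omega
  | succ N ih =>
    intro g α β γ δ hg hα hβ hγ hδ hdet ha hc hN
    by_cases h0 : β = 0 ∧ γ = 0
    · obtain ⟨rfl, rfl⟩ := h0
      have h1 : α * δ = 1 := by linarith
      have h2 : α = 1 := by nlinarith
      have h3 : δ = 1 := by subst h2; linarith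
      subst h2 h3
      exact ⟨0, (transform_one g).symm⟩
    have key : (γ < α ∧ δ ≤ β) ∨ (α ≤ γ ∧ β < δ) := by
      rcases lt_or_ge γ α with h | h
      · left
        refine ⟨h, ?_⟩
        by_contra hlt
        push Not at hlt
        apply h0
        constructor <;> nlinarith [mul_nonneg (by linarith : 0 ≤ α - γ - 1) (by linarith : 0 ≤ δ - β - 1),
          mul_nonneg hβ (by linarith : 0 ≤ α - γ - 1), mul_nonneg hγ (by linarith : 0 ≤ δ - β - 1)]
      · right
        refine ⟨h, ?_⟩
        by_contra hlt
        push Not at hlt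
        nlinarith
    obtain ⟨hgI, hg1, hg2⟩ := id hg
    rcases key with ⟨k1, k2⟩ | ⟨k1, k2⟩
    · have hv : 0 < v g := by
        by_contra hv
        push Not at hv
        obtain ⟨k, rfl⟩ : ∃ k, β = δ + k := ⟨β - δ, by ring⟩
        have hk : 0 ≤ k := by linarith
        have e : (g.transform α (δ + k) γ δ).c
            = v g * δ ^ 2 + (v g + g.a - g.c) * (k * δ) + g.a * k ^ 2 := by
          simp only [QF.transform, v]; ring
        rw [e] at hc
        nlinarith [mul_nonneg hk hδ.le, sq_nonneg k, sq_nonneg δ]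
      have e : (nxt g).transform (α - γ) (β - δ) γ δ = g.transform α β γ δ := by
        rw [nxt_pos hv]
        apply qf_ext <;> simp only [QF.transform] <;> ring
      obtain ⟨n, hn⟩ := ih (nxt g) (α - γ) (β - δ) γ δ hg.nxt (by linarith) (by linarith) hγ hδ
        (by linarith) (by rwa [e]) (by rwa [e]) (by omega)
      exact ⟨n + 1, by rw [Function.iterate_succ_apply, hn, e]⟩
    · have hv : ¬ 0 < v g := by
        intro hv
        obtain ⟨k, rfl⟩ : ∃ k, γ = α + k := ⟨γ - α, by ring⟩
        have hk : 0 ≤ k := by linarith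
        have e : (g.transform α β (α + k) δ).a
            = v g * α ^ 2 + (v g + g.c - g.a) * (k * α) + g.c * k ^ 2 := by
          simp only [QF.transform, v]; ring
        rw [e] at ha
        nlinarith [mul_nonneg hk hα.le, sq_nonneg k, sq_nonneg α]
      have e : (nxt g).transform α β (γ - α) (δ - β) = g.transform α β γ δ := by
        rw [nxt_neg hv]
        apply qf_ext <;> simp only [QF.transform] <;> ring
      obtain ⟨n, hn⟩ := ih (nxt g) α β (γ - α) (δ - β) hg.nxt hα hβ (by linarith) (by linarith)
        (by linarith) (by rwa [e]) (by rwa [e]) (by omega)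
      exact ⟨n + 1, by rw [Function.iterate_succ_apply, hn, e]⟩

theorem orbit_pos {g : QF} {α β γ δ : ℤ} (hg : River g) (hα : 0 < α)
    (hdet : α * δ - β * γ = 1) (hg' : River (g.transform α β γ δ)) :
    (∃ n, nxt^[n] g = g.transform α β γ δ) ∨ (∃ n, nxt^[n] (g.transform α β γ δ) = g) := by
  obtain ⟨_, ha, hc⟩ := id hg'
  obtain ⟨_, h1, h2⟩ := id hg
  have hδ : 0 < δ := by
    by_contra hδ
    push Not at hδ
    have hbg : β * γ < 0 := by nlinarith
    simp only [QF.transform] at ha hc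
    -- cross identity
    have id1 : (g.a * α ^ 2 + g.b * α * γ + g.c * γ ^ 2) * (β * δ)
        - (g.a * β ^ 2 + g.b * β * δ + g.c * δ ^ 2) * (α * γ)
        = (α * δ - β * γ) * (g.a * (α * β) - g.c * (γ * δ)) := by ring
    rw [hdet, one_mul] at id1
    rcases lt_or_ge 0 β with hb | hb
    · have hγ : γ < 0 := by nlinarith
      have t1 : 0 < α * β := mul_pos hα hb
      have t2 : 0 ≤ γ * δ := by nlinarith
      have t3 : α * γ < 0 := by nlinarith
      have t4 : β * δ ≤ 0 := by nlinarith
      nlinarith [mul_nonneg (neg_nonneg.2 ha.le) (neg_nonneg.2 t4), mul_pos hc (neg_pos.2 t3),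
        mul_pos (neg_pos.2 h1) t1, mul_nonneg h2.le t2]
    · have hb' : β < 0 := lt_of_le_of_ne hb (by rintro rfl; simp at hbg)
      have hγ : 0 < γ := by nlinarith
      have t1 : α * β < 0 := by nlinarith
      have t2 : γ * δ ≤ 0 := by nlinarith
      have t3 : 0 < α * γ := by nlinarith
      have t4 : 0 ≤ β * δ := by nlinarith
      nlinarith [mul_nonneg (neg_nonneg.2 ha.le) t4, mul_pos hc t3,
        mul_pos (neg_pos.2 h1) (neg_pos.2 t1), mul_nonneg h2.le (neg_nonneg.2 t2)]
  have hbg : 0 ≤ β * γ := by nlinarith [mul_pos hα hδ]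
  by_cases hnn : 0 ≤ β ∧ 0 ≤ γ
  · left
    exact orbit_nonneg _ g α β γ δ hg hα hnn.1 hnn.2 hδ hdet ha hc le_rfl
  · right
    have hnp : β ≤ 0 ∧ γ ≤ 0 := by
      constructor
      · by_contra h
        push Not at h
        apply hnn
        exact ⟨h.le, by by_contra h'; push Not at h'; nlinarith⟩
      · by_contra h
        push Not at h
        apply hnn
        exact ⟨by by_contra h'; push Not at h'; nlinarith, h.le⟩
    have e := fe_inv g hdet
    obtain ⟨n, hn⟩ := orbit_nonneg _ (g.transform α β γ δ) δ (-β) (-γ) α hg' hδ (by linarith [hnp.1])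
      (by linarith [hnp.2]) hα (by linarith) (by rw [e]; exact h1) (by rw [e]; exact h2) le_rfl
    exact ⟨n, by rw [hn, e]⟩

theorem orbit {g g' : QF} (hg : River g) (hg' : River g') (h : FormEquiv g g') :
    (∃ n, nxt^[n] g = g') ∨ (∃ n, nxt^[n] g' = g) := by
  obtain ⟨α, β, γ, δ, hdet, rfl⟩ := h
  rcases lt_trichotomy α 0 with h | h | h
  · have e : g.transform α β γ δ = g.transform (-α) (-β) (-γ) (-δ) := by
      apply qf_ext <;> simp only [QF.transform] <;> ring
    rw [e] at hg' ⊢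
    exact orbit_pos hg (by linarith) (by linarith) hg'
  · subst h
    have := hg'.2.1
    simp only [QF.transform] at this
    nlinarith [sq_nonneg γ, hg.2.2]
  · exact orbit_pos hg h hdet hg'

theorem orbit_periodic {g g' : QF} (hg : River g) (hg' : River g') (h : FormEquiv g g')
    {N : ℕ} (hN : 0 < N) (hp : nxt^[N] g = g) : ∃ n, nxt^[n] g = g' := by
  rcases orbit hg hg' h with h | ⟨n, hn⟩
  · exact h
  · refine ⟨n * (N - 1), ?_⟩
    apply iter_inj n (hg.iter _) hg'
    rw [← Function.iterate_add_apply, hn]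
    have : n + n * (N - 1) = N * n := by
      obtain ⟨M, rfl⟩ : ∃ M, N = M + 1 := ⟨N - 1, by omega⟩
      simp; ring
    rw [this]
    exact (Function.IsPeriodicPt.mul_const (show Function.IsPeriodicPt nxt N g from hp) n)

/-! ### From Z-reduced forms to river forms -/

def riv (f : QF) : QF := ⟨f.a - f.b + f.c, f.b - 2 * f.c, f.c⟩
def unriv (g : QF) : QF := ⟨g.a + g.b + g.c, g.b + 2 * g.c, g.c⟩

theorem unriv_riv (f : QF) : unriv (riv f) = f := by
  apply qf_ext <;> simp only [riv, unriv] <;> ring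

theorem riv_unriv (f : QF) : riv (unriv f) = f := by
  apply qf_ext <;> simp only [riv, unriv] <;> ring

theorem fe_riv (f : QF) : FormEquiv f (riv f) :=
  ⟨1, 0, -1, 1, by norm_num, by apply qf_ext <;> simp only [riv, QF.transform] <;> ring⟩

theorem disc_riv (f : QF) : (riv f).disc = f.disc := by
  simp only [riv, QF.disc]; ring

theorem riv_iff (f : QF) : f.IsZReduced ↔ River (riv f) ∧ 0 < v (riv f) := by
  unfold QF.IsZReduced River QF.IsIndefinite
  rw [disc_riv]
  simp only [riv, v]
  constructor
  · rintro ⟨h, h1, h2, h3, h4⟩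
    exact ⟨⟨h, by linarith, h3⟩, by linarith⟩
  · rintro ⟨⟨h, h1, h2⟩, h3⟩
    exact ⟨h, by linarith, by linarith, h2, by linarith⟩

theorem caliber {f : QF} (hf : f.IsZReduced) {n : ℕ} (hn : 0 < n)
    (hmin : Function.minimalPeriod nxt (riv f) = n) :
    {g : QF | g.IsZReduced ∧ FormEquiv f g}.ncard =
      ((Finset.range n).filter (fun i => 0 < v (nxt^[i] (riv f)))).card := by
  have hR := ((riv_iff f).1 hf).1
  have hp : nxt^[n] (riv f) = riv f := by
    rw [← hmin]; exact Function.iterate_minimalPeriod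
  have hinj : Set.InjOn (fun i => unriv (nxt^[i] (riv f)))
      ((Finset.range n).filter (fun i => 0 < v (nxt^[i] (riv f))) : Finset ℕ) := by
    intro i hi j hj e
    simp only [Finset.coe_filter, Finset.mem_range, Set.mem_ofPred_eq] at hi hj
    have e' : nxt^[i] (riv f) = nxt^[j] (riv f) := by
      have := congrArg riv e
      simpa only [riv_unriv] using this
    have := Function.iterate_injOn_Iio_minimalPeriod (f := nxt) (x := riv f)
    rw [hmin] at this
    exact this hi.1 hj.1 e'
  rw [← Set.ncard_coe_finset, ← Set.InjOn.ncard_image hinj]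
  congr 1
  ext g
  simp only [Set.mem_ofPred_eq, Finset.coe_filter, Finset.mem_range, Set.mem_image]
  constructor
  · rintro ⟨hg, he⟩
    have hgR := (riv_iff g).1 hg
    obtain ⟨m, hm⟩ := orbit_periodic hR hgR.1
      (fe_trans (fe_symm (fe_riv f)) (fe_trans he (fe_riv g))) hn hp
    have hm' : nxt^[m % n] (riv f) = riv g := by
      rw [← hm, ← hmin, Function.iterate_mod_minimalPeriod_eq]
    exact ⟨m % n, ⟨Nat.mod_lt _ hn, by rw [hm']; exact hgR.2⟩, by rw [hm', unriv_riv]⟩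
  · rintro ⟨i, ⟨hi, hv⟩, rfl⟩
    constructor
    · rw [riv_iff, riv_unriv]; exact ⟨hR.iter i, hv⟩
    · refine fe_trans (fe_riv f) (fe_trans (fe_iter _ i) (fe_symm ?_))
      have := fe_riv (unriv (nxt^[i] (riv f)))
      rwa [riv_unriv] at this

/-! ### Matrices attached to binary strings -/

/-- Two by two integer matrices. -/
structure M2 where
  a : ℤ
  b : ℤ
  c : ℤ
  d : ℤ

/-- The product of the matrices `[[1,1],[0,1]]` (for `0`) and `[[1,1],[1,0]]` (for `1`). -/
def NM : List Bool → M2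
  | [] => ⟨1, 0, 0, 1⟩
  | false :: s => ⟨(NM s).a + (NM s).c, (NM s).b + (NM s).d, (NM s).c, (NM s).d⟩
  | true :: s => ⟨(NM s).a + (NM s).c, (NM s).b + (NM s).d, (NM s).a, (NM s).b⟩

theorem NM_snoc_false (s : List Bool) :
    NM (s ++ [false]) = ⟨(NM s).a, (NM s).a + (NM s).b, (NM s).c, (NM s).c + (NM s).d⟩ := by
  induction s with
  | nil => simp [NM]
  | cons b s ih =>
    cases b <;> simp only [List.cons_append, NM, ih, M2.mk.injEq, and_true, true_and] <;> ring

theorem NM_snoc_true (s : List Bool) :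
    NM (s ++ [true]) = ⟨(NM s).a + (NM s).b, (NM s).a, (NM s).c + (NM s).d, (NM s).c⟩ := by
  induction s with
  | nil => simp [NM]
  | cons b s ih =>
    cases b <;> simp only [List.cons_append, NM, ih, M2.mk.injEq, and_true, true_and] <;> ring

theorem NM_pos (s : List Bool) : 1 ≤ (NM s).a ∧ 0 ≤ (NM s).b ∧ 0 ≤ (NM s).c ∧ 0 ≤ (NM s).d ∧
    0 < (NM s).c + (NM s).d := by
  induction s with
  | nil => simp [NM]
  | cons b s ih =>
    cases b <;> simp only [NM] <;> omega

theorem NM_det (s : List Bool) :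
    (NM s).a * (NM s).d - (NM s).b * (NM s).c = (-1) ^ (s.count true) := by
  induction s with
  | nil => simp [NM]
  | cons b s ih =>
    cases b
    · simp only [NM, List.count_cons]
      simp
      linarith
    · simp only [NM, List.count_cons]
      simp [pow_succ]
      linarith

/-- `u • g` is the form attached to the matrix of `s`. -/
def Rep (u : ℤ) (g : QF) (s : List Bool) : Prop :=
  u * g.a = -(NM s).c ∧ u * g.b = (NM s).a - (NM s).d ∧ u * g.c = (NM s).b

def fl (b : Bool) (g : QF) : QF := if b then flip g else g

theorem fl_fl (b c : Bool) (g : QF) : fl b (fl c g) = fl (xor c b) g := by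
  cases b <;> cases c <;> simp [fl, flip_flip]

theorem River.flip {g : QF} (h : River g) : River (flip g) := by
  obtain ⟨h, h1, h2⟩ := h
  refine ⟨?_, by simp only [ZCal.flip]; linarith, by simp only [ZCal.flip]; linarith⟩
  have : (ZCal.flip g).disc = g.disc := by simp only [ZCal.flip, QF.disc]; ring
  unfold QF.IsIndefinite
  rwa [this]

theorem River.fl {g : QF} (h : River g) (b : Bool) : River (fl b g) := by
  cases b
  · simpa [ZCal.fl] using h
  · simpa [ZCal.fl] using h.flip

theorem nxt_fl {g : QF} (h : River g) (b : Bool) : nxt (fl b g) = fl b (nxt g) := by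
  cases b
  · simp [fl]
  · simpa [fl] using nxt_flip h

theorem rep_step {u : ℤ} (hu : 0 < u) {g : QF} {b : Bool} {s : List Bool}
    (h : Rep u g (b :: s)) : 0 < v g ∧ Rep u (fl b (nxt g)) (s ++ [b]) := by
  obtain ⟨h1, h2, h3⟩ := h
  have hp := NM_pos s
  have hv : 0 < v g := by
    have : 0 < u * v g := by
      have e : u * v g = u * g.a + u * g.b + u * g.c := by unfold v; ring
      rw [e, h1, h2, h3]
      cases b <;> simp only [NM] <;> linarith
    exact pos_of_mul_pos_right this hu.le
  refine ⟨hv, ?_⟩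
  rw [nxt_pos hv]
  cases b
  · simp only [Rep, fl, NM_snoc_false]
    simp only [NM] at h1 h2 h3
    simp
    refine ⟨h1, ?_, ?_⟩ <;> linarith
  · simp only [Rep, fl, flip, NM_snoc_true]
    simp only [NM] at h1 h2 h3
    simp
    refine ⟨?_, ?_, ?_⟩ <;> linarith

/-- The `i`-th bit of the periodic extension of `s`. -/
def bt (s : List Bool) (i : ℕ) : Bool := (s.rotate i).headD false

/-- The parity of the number of ones among the first `i` bits. -/
def E (s : List Bool) : ℕ → Bool
  | 0 => false
  | i + 1 => xor (E s i) (bt s i)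

theorem rotate_eq_cons {s : List Bool} (hs : s ≠ []) (i : ℕ) :
    ∃ r, s.rotate i = bt s i :: r ∧ s.rotate (i + 1) = r ++ [bt s i] := by
  have h : s.rotate i ≠ [] := by simpa using hs
  unfold bt
  rw [← List.rotate_rotate]
  cases h' : s.rotate i with
  | nil => exact absurd h' h
  | cons b r => exact ⟨r, by simp, by simp⟩

theorem rep_iter {u : ℤ} (hu : 0 < u) {g : QF} (hg : River g) {s : List Bool} (hs : s ≠ [])
    (h : Rep u g s) (i : ℕ) : Rep u (fl (E s i) (nxt^[i] g)) (s.rotate i) := by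
  induction i with
  | zero => simpa [E, fl] using h
  | succ i ih =>
    obtain ⟨r, h1, h2⟩ := rotate_eq_cons hs i
    rw [h1] at ih
    have := (rep_step hu ih).2
    rw [nxt_fl (hg.iter i), fl_fl] at this
    rw [h2, Function.iterate_succ_apply']
    exact this

theorem letter {u : ℤ} (hu : 0 < u) {g : QF} (hg : River g) {s : List Bool} (hs : s ≠ [])
    (h : Rep u g s) (i : ℕ) : 0 < v (nxt^[i] g) ↔ E s i = false := by
  have h3 := rep_iter hu hg hs h i
  obtain ⟨r, h1, h2⟩ := rotate_eq_cons hs i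
  rw [h1] at h3
  have := (rep_step hu h3).1
  cases hE : E s i
  · rw [hE] at this
    simpa [fl] using this
  · rw [hE] at this
    simp only [fl, if_true, v_flip] at this
    simp; linarith

theorem rep_unique {u : ℤ} (hu : 0 < u) {g g' : QF} {s : List Bool}
    (h : Rep u g s) (h' : Rep u g' s) : g = g' := by
  obtain ⟨h1, h2, h3⟩ := h
  obtain ⟨h1', h2', h3'⟩ := h'
  apply qf_ext <;> apply mul_left_cancel₀ hu.ne'
  · rw [h1, h1']
  · rw [h2, h2']
  · rw [h3, h3']

theorem bt_rotate (s : List Bool) (m i : ℕ) : bt (s.rotate m) i = bt s (m + i) := by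
  simp [bt, List.rotate_rotate]

theorem E_rotate (s : List Bool) (m i : ℕ) :
    E (s.rotate m) i = xor (E s (m + i)) (E s m) := by
  induction i with
  | zero => simp [E]
  | succ i ih =>
    rw [E, ih, bt_rotate, ← add_assoc, E]
    cases E s (m + i) <;> cases E s m <;> cases bt s (m + i) <;> rfl

theorem bt_lt {s : List Bool} {i : ℕ} (h : i < s.length) : bt s i = s[i] := by
  unfold bt
  rw [List.headD_eq_head?_getD, List.head?_rotate h]
  simp [h]

theorem E_le (s : List Bool) (i : ℕ) (h : i ≤ s.length) :
    E s i = decide (Odd ((s.take i).count true)) := by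
  induction i with
  | zero => simp [E]
  | succ i ih =>
    rw [E, ih (by omega), bt_lt (by omega), List.take_succ_eq_append_getElem (by omega),
      List.count_append]
    cases s[i]
    · simp
    · simp [Nat.odd_add_one, ← Nat.not_even_iff_odd]

theorem E_length (s : List Bool) : E s s.length = decide (Odd (s.count true)) := by
  rw [E_le s _ le_rfl, List.take_length]

theorem E_add_length (s : List Bool) (i : ℕ) :
    E s (s.length + i) = xor (E s i) (E s s.length) := by
  have := E_rotate s s.length i
  rw [List.rotate_length] at this
  rw [this]
  cases E s (s.length + i) <;> cases E s s.length <;> rfl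

/-- A period of the bit sequence of a primitive string is a multiple of its length. -/
theorem dvd_of_period {s : List Bool} (hs : PrimitiveList s) {n : ℕ}
    (h : ∀ i, bt s (n + i) = bt s i) : s.length ∣ n := by
  have hlen : 0 < s.length := List.length_pos_iff.2 hs.1
  have e : s.rotate n = s := by
    apply List.ext_getElem (by simp)
    intro i h1 h2
    rw [← bt_lt h1, ← bt_lt h2, bt_rotate, h]
  by_contra hd
  apply hs.2 (n % s.length) (Nat.pos_of_ne_zero fun h0 => hd (Nat.dvd_of_mod_eq_zero h0))
    (Nat.mod_lt _ hlen)
  rw [List.rotate_mod, e]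

theorem length_dvd_minimalPeriod {u : ℤ} (hu : 0 < u) {g : QF} (hg : River g) {s : List Bool}
    (hs : PrimitiveList s) (h : Rep u g s) : s.length ∣ Function.minimalPeriod nxt g := by
  apply dvd_of_period hs
  have hE : ∀ i, E s (Function.minimalPeriod nxt g + i) = E s i := by
    intro i
    have h1 := letter hu hg hs.1 h (Function.minimalPeriod nxt g + i)
    have h2 := letter hu hg hs.1 h i
    rw [add_comm, Function.iterate_add_apply, Function.iterate_minimalPeriod, h2] at h1
    rw [add_comm]
    cases hh : E s i <;> cases hh' : E s (i + Function.minimalPeriod nxt g) <;> simp_all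
  intro i
  have h1 := hE (i + 1)
  have h2 := hE i
  rw [← add_assoc, E, E, h2] at h1
  generalize bt s (Function.minimalPeriod nxt g + i) = x at *
  generalize bt s i = y at *
  generalize E s i = z at *
  cases x <;> cases y <;> cases z <;> simp_all

theorem iter_length {u : ℤ} (hu : 0 < u) {g : QF} (hg : River g) {s : List Bool}
    (hs : s ≠ []) (h : Rep u g s) : nxt^[s.length] g = fl (E s s.length) g := by
  have h1 := rep_iter hu hg hs h s.length
  rw [List.rotate_length] at h1
  have := rep_unique hu h h1
  conv_rhs => rw [this]
  rw [fl_fl]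
  simp [fl]

theorem minPer_even {u : ℤ} (hu : 0 < u) {g : QF} (hg : River g) {s : List Bool}
    (hs : PrimitiveList s) (h : Rep u g s) (hE : Even (s.count true)) :
    Function.minimalPeriod nxt g = s.length := by
  apply Nat.dvd_antisymm _ (length_dvd_minimalPeriod hu hg hs h)
  apply Function.IsPeriodicPt.minimalPeriod_dvd
  have h1 := iter_length hu hg hs.1 h
  rw [E_length, decide_eq_false (by simpa using hE)] at h1
  exact h1

theorem minPer_odd {u : ℤ} (hu : 0 < u) {g : QF} (hg : River g) {s : List Bool}
    (hs : PrimitiveList s) (h : Rep u g s) (hE : Odd (s.count true)) :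
    Function.minimalPeriod nxt g = 2 * s.length := by
  have h1 := iter_length hu hg hs.1 h
  rw [E_length, decide_eq_true hE] at h1
  have hlen : 0 < s.length := List.length_pos_iff.2 hs.1
  have h2 : Function.minimalPeriod nxt g ∣ 2 * s.length := by
    apply Function.IsPeriodicPt.minimalPeriod_dvd
    change nxt^[2 * s.length] g = g
    rw [two_mul, Function.iterate_add_apply, h1]
    have h3 : ∀ n, nxt^[n] (fl true g) = fl true (nxt^[n] g) := by
      intro n
      induction n with
      | zero => rfl
      | succ n ih =>
        rw [Function.iterate_succ_apply', ih, nxt_fl (hg.iter n), Function.iterate_succ_apply']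
    rw [h3, h1, fl_fl]
    simp [fl]
  obtain ⟨k, hk⟩ := length_dvd_minimalPeriod hu hg hs h
  rw [hk] at h2
  have hk2 : k ∣ 2 := by
    rw [mul_comm 2] at h2
    exact Nat.dvd_of_mul_dvd_mul_left hlen h2
  rcases (Nat.dvd_prime Nat.prime_two).1 hk2 with rfl | rfl
  · exfalso
    have h3 : nxt^[Function.minimalPeriod nxt g] g = g := Function.iterate_minimalPeriod
    rw [hk, mul_one, h1] at h3
    have h4 := congrArg v h3
    simp only [fl, if_true, v_flip] at h4
    have := hg.v_ne
    omega
  · rw [hk, mul_comm]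

/-! ### The bead sequence -/

theorem NM_replicate (k : ℕ) (s : List Bool) : NM (List.replicate k false ++ s) =
    ⟨(NM s).a + k * (NM s).c, (NM s).b + k * (NM s).d, (NM s).c, (NM s).d⟩ := by
  induction k with
  | zero => simp
  | succ k ih =>
    rw [List.replicate_succ, List.cons_append, NM, ih]
    simp only [M2.mk.injEq, and_true]
    push_cast
    constructor <;> ring

theorem NM_sb (L : List ℤ) (hL : L ≠ []) (hpos : ∀ q ∈ L, 0 < q) :
    (NM (sb L)).a + (NM (sb L)).b = cont L ∧ (NM (sb L)).c + (NM (sb L)).d = cont L.tail := by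
  induction L with
  | nil => exact absurd rfl hL
  | cons q L ih =>
    have hq : ((q - 1).toNat : ℤ) = q - 1 := Int.toNat_of_nonneg (by have := hpos q (by simp); omega)
    cases L with
    | nil =>
      have := NM_replicate (q - 1).toNat []
      rw [List.append_nil] at this
      simp only [sb, this, NM, cont, List.tail_cons, hq]
      constructor <;> ring
    | cons r t =>
      have ih := ih (by simp) (fun x hx => hpos x (by simp [hx]))
      simp only [List.tail_cons] at ih ⊢
      simp only [sb, NM_replicate, NM, cont, hq]
      rw [← ih.1, ← ih.2]
      constructor <;> ring

theorem count_sb (L : List ℤ) (hL : L ≠ []) : (sb L).count true + 1 = L.length := by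
  induction L with
  | nil => exact absurd rfl hL
  | cons q L ih =>
    cases L with
    | nil => simp [sb, List.count_replicate]
    | cons r t =>
      have ih := ih (by simp)
      simp only [sb, List.count_append, List.count_replicate, List.count_cons] at ih ⊢
      simp at ih ⊢
      omega

theorem matrix_unique {m n a c z y x w D : ℤ} (hD : D * D = 1) (hm : 0 < m) (hz : 0 < z)
    (hcr : m * y = z * n) (h1 : z * w - y * x = D) (h2 : m * c - n * a = D)
    (ha : 1 ≤ a) (ham : a ≤ m) (hx : 0 < x) (hxz : x < z) :
    m = z ∧ n = y ∧ a = x ∧ c = w := by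
  have d1 : z ∣ m := ⟨D * (m * w - n * x), by
    linear_combination (-m) * hD + (-m * D) * h1 + (-D * x) * hcr⟩
  have d2 : m ∣ z := ⟨D * (z * c - y * a), by
    linear_combination (-z) * hD + (-z * D) * h2 + (D * a) * hcr⟩
  have hmz : m = z := Int.dvd_antisymm hm.le hz.le d2 d1
  subst hmz
  have hny : n = y := (mul_left_cancel₀ hm.ne' hcr).symm
  subst hny
  have d3 : m ∣ a - x := ⟨D * (w * (a - x) - x * (c - w)), by
    linear_combination (-(a - x)) * hD + (-(a - x) * D) * h1 + (D * x) * (h2 - h1)⟩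
  have hax : a = x := by
    have : a - x = 0 := Int.eq_zero_of_abs_lt_dvd d3 (by rw [abs_lt]; constructor <;> linarith)
    linarith
  subst hax
  refine ⟨rfl, rfl, rfl, ?_⟩
  apply mul_left_cancel₀ hm.ne'
  linarith

theorem rep_of_sigma {f : QF} (hf : f.IsZReduced) {s : List Bool} (h : f.IsSigma s) :
    ∃ u, 0 < u ∧ Rep u (riv f) s := by
  obtain ⟨L, ⟨t, u, ⟨ht, hu, habs, -⟩, ⟨hL, hpos, hcf⟩, hev, hod⟩, rfl⟩ := h
  refine ⟨u, hu, ?_⟩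
  obtain ⟨A, B, C⟩ := f
  obtain ⟨_, hA, hB, hC, hAC⟩ := hf
  simp only [QF.disc] at *
  obtain ⟨ε, hε, hN⟩ : ∃ ε : ℤ, (ε = 1 ∨ ε = -1) ∧ t ^ 2 - (B ^ 2 - 4 * A * C) * u ^ 2 = 4 * ε := by
    rcases (abs_eq (by norm_num)).1 habs with h | h
    · exact ⟨1, Or.inl rfl, by rw [h]; norm_num⟩
    · exact ⟨-1, Or.inr rfl, by rw [h]; norm_num⟩
  obtain ⟨z, hz⟩ : ∃ z, t + B * u = 2 * z := by
    rcases Int.even_or_odd' (t + B * u) with ⟨z, h | h⟩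
    · exact ⟨z, h⟩
    · exfalso
      have e : (t + B * u) * (t - B * u) = 4 * (ε - A * C * u ^ 2) := by linarith
      have e2 : t - B * u = 2 * (z - B * u) + 1 := by linarith
      rw [h, e2] at e
      have e3 : 2 * (2 * z * (z - B * u) + z + (z - B * u)) + 1 = 2 * (2 * (ε - A * C * u ^ 2)) := by
        linarith
      omega
  have hBu : 3 ≤ B * u := by nlinarith
  have hzpos : 0 < z := by linarith
  have hdet : z * ((B - A - C) * u) - (z - A * u) * (z - C * u) = -ε := by
    have ht' : t = 2 * z - B * u := by linarith
    rw [ht'] at hN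
    linarith
  have hxpos : 0 < z - C * u := by
    by_contra hx
    push Not at hx
    have h1 : t ≤ (2 * C - B) * u := by linarith
    have h2 : t ^ 2 ≤ ((2 * C - B) * u) ^ 2 := pow_le_pow_left₀ ht.le h1 2
    have h3 : C * (B - A - C) * u ^ 2 ≤ 1 := by
      have : -1 ≤ ε := by rcases hε with h | h <;> rw [h] <;> norm_num
      nlinarith
    have h4 : 1 ≤ (B - A - C) * u ^ 2 := by nlinarith
    have h5 : C ≤ 1 := by nlinarith
    have h6 : 2 * C - B ≤ 0 := by linarith
    nlinarith
  obtain ⟨hc1, hc2⟩ := NM_sb L hL hpos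
  have hp := NM_pos (sb L)
  have hd := NM_det (sb L)
  have hcnt := count_sb L hL
  set X := NM (sb L) with hX
  have hD : X.a * X.d - X.b * X.c = ε := by
    rw [hd]
    rcases hε with h | h
    · have : Odd L.length := hod (by rw [hN, h]; norm_num)
      have : Even ((sb L).count true) := by
        rw [← hcnt] at this
        simpa [Nat.odd_add_one] using this
      rw [this.neg_one_pow, h]
    · have : Even L.length := hev (by rw [hN, h]; norm_num)
      have : Odd ((sb L).count true) := by
        rw [← hcnt] at this
        simpa [Nat.even_add_one] using this
      rw [this.neg_one_pow, h]
  have hy : z - A * u ≠ 0 := by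
    intro h0
    have hq : (((t + B * u : ℤ) : ℚ) / 2 - ((A * u : ℤ) : ℚ)) = 0 := by
      rw [hz]
      have : ((z - A * u : ℤ) : ℚ) = 0 := by rw [h0]; simp
      push_cast at this ⊢
      linarith
    rw [hq, div_zero, zero_mul, ← hc1] at hcf
    have : X.a + X.b = 0 := by exact_mod_cast hcf
    linarith [hp.1, hp.2.1]
  have hcr : (X.a + X.b) * (z - A * u) = z * (X.c + X.d) := by
    have hq1 : ((t + B * u : ℤ) : ℚ) / 2 = (z : ℚ) := by
      rw [hz]; push_cast; ring
    have hq2 : (z : ℚ) - ((A * u : ℤ) : ℚ) ≠ 0 := by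
      have : ((z - A * u : ℤ) : ℚ) ≠ 0 := by exact_mod_cast hy
      push_cast at this ⊢
      exact this
    rw [hq1, ← hc1, ← hc2] at hcf
    field_simp at hcf
    have : (((X.a + X.b) * (z - A * u) : ℤ) : ℚ) = ((z * (X.c + X.d) : ℤ) : ℚ) := by
      push_cast at hcf ⊢
      linarith
    exact_mod_cast this
  have hCu : 0 < C * u := mul_pos hC hu
  obtain ⟨r1, r2, r3, r4⟩ := matrix_unique (D := -ε) (by rcases hε with h | h <;> rw [h] <;> norm_num)
    (show 0 < X.a + X.b by linarith [hp.1, hp.2.1]) hzpos hcr hdet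
    (show (X.a + X.b) * X.c - (X.c + X.d) * X.a = -ε by linarith) hp.1 (by linarith [hp.2.1])
    hxpos (by linarith)
  simp only [Rep, riv]
  rw [← hX]
  refine ⟨?_, ?_, ?_⟩ <;> linarith

/-! ### Primitive forms -/

theorem bez_of_prim {f : QF} (h : IsPrimitiveForm f) :
    ∃ x y z : ℤ, f.a * x + f.b * y + f.c * z = 1 := by
  unfold IsPrimitiveForm at h
  have h1 := Int.gcd_eq_gcd_ab f.a (Int.gcd f.b f.c)
  have h2 := Int.gcd_eq_gcd_ab f.b f.c
  rw [h] at h1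
  generalize Int.gcdB f.a (Int.gcd f.b f.c) = y at h1
  generalize Int.gcdA f.a (Int.gcd f.b f.c) = x at h1
  rw [h2] at h1
  push_cast at h1
  exact ⟨x, f.b.gcdA f.c * y, f.b.gcdB f.c * y, by linarith⟩

theorem bez_transform {f : QF} {α β γ δ : ℤ} (hdet : α * δ - β * γ = 1)
    (h : ∃ x y z : ℤ, (f.transform α β γ δ).a * x + (f.transform α β γ δ).b * y
      + (f.transform α β γ δ).c * z = 1) :
    ∃ x y z : ℤ, f.a * x + f.b * y + f.c * z = 1 := by
  obtain ⟨x, y, z, h⟩ := h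
  refine ⟨α ^ 2 * x + 2 * α * β * y + β ^ 2 * z, α * γ * x + (α * δ + β * γ) * y + β * δ * z,
    γ ^ 2 * x + 2 * γ * δ * y + δ ^ 2 * z, ?_⟩
  rw [← h]
  simp only [QF.transform]
  ring

theorem bez_fe {f g : QF} (hfg : FormEquiv f g) (h : ∃ x y z : ℤ, f.a * x + f.b * y + f.c * z = 1) :
    ∃ x y z : ℤ, g.a * x + g.b * y + g.c * z = 1 := by
  obtain ⟨α, β, γ, δ, e, rfl⟩ := fe_symm hfg
  exact bez_transform e h

theorem dvd_of_rep {u w : ℤ} {g h : QF} {s : List Bool}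
    (r1 : Rep u g s) (r2 : Rep w h s)
    (h2 : ∃ x y z : ℤ, h.a * x + h.b * y + h.c * z = 1) : u ∣ w := by
  obtain ⟨x, y, z, e⟩ := h2
  obtain ⟨a1, b1, c1⟩ := r1
  obtain ⟨a2, b2, c2⟩ := r2
  exact ⟨g.a * x + g.b * y + g.c * z, by
    linear_combination (-w) * e + x * (a2 - a1) + y * (b2 - b1) + z * (c2 - c1)⟩

theorem eq_of_rep {u w : ℤ} (hu : 0 < u) (hw : 0 < w) {g h : QF} {s : List Bool}
    (r1 : Rep u g s) (r2 : Rep w h s)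
    (h1 : ∃ x y z : ℤ, g.a * x + g.b * y + g.c * z = 1)
    (h2 : ∃ x y z : ℤ, h.a * x + h.b * y + h.c * z = 1) : g = h := by
  have : u = w := Int.dvd_antisymm hu.le hw.le (dvd_of_rep r1 r2 h2) (dvd_of_rep r2 r1 h1)
  subst this
  exact rep_unique hu r1 r2

theorem prim_rotate {s : List Bool} (hs : PrimitiveList s) (n : ℕ) :
    PrimitiveList (s.rotate n) := by
  refine ⟨by simpa using hs.1, ?_⟩
  intro k hk hk' e
  rw [List.length_rotate] at hk'
  apply hs.2 k hk hk'
  rw [List.rotate_rotate, add_comm, ← List.rotate_rotate] at e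
  exact List.rotate_injective n e

theorem count_rotate (s : List Bool) (n : ℕ) : (s.rotate n).count true = s.count true :=
  (List.rotate_perm s n).count_eq true

/-- If `s` is a rotation of `s'`, then `s'` is a rotation of `s`. -/
theorem rotate_symm {s s' : List Bool} (h : ∃ n : ℕ, s'.rotate n = s) : ∃ n, s' = s.rotate n := by
  have h' : s' ~r s := h
  obtain ⟨n, hn⟩ := h'.symm
  exact ⟨n, hn.symm⟩

theorem caliber_odd {f : QF} (hf : f.IsZReduced) {s : List Bool} (hs : PrimitiveList s)
    (hsig : f.IsSigma s) (hodd : Odd (s.count true)) :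
    s.length = {g : QF | g.IsZReduced ∧ FormEquiv f g}.ncard := by
  obtain ⟨u, hu, hr⟩ := rep_of_sigma hf hsig
  have hR := ((riv_iff f).1 hf).1
  have hlen : 0 < s.length := List.length_pos_iff.2 hs.1
  rw [caliber hf (by positivity) (minPer_odd hu hR hs hr hodd)]
  simp only [letter hu hR hs.1 hr]
  have hEl : E s s.length = true := by rw [E_length]; exact decide_eq_true hodd
  rw [Finset.card_filter, two_mul, Finset.sum_range_add, ← Finset.sum_add_distrib]
  have : ∀ i ∈ Finset.range s.length, ((if E s i = false then 1 else 0) +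
      (if E s (s.length + i) = false then 1 else 0)) = 1 := by
    intro i _
    rw [E_add_length, hEl]
    cases E s i <;> simp
  rw [Finset.sum_congr rfl this]
  simp

theorem caliber_even {f : QF} (hf : f.IsZReduced) {s : List Bool} (hs : PrimitiveList s)
    (hsig : f.IsSigma s) (hev : Even (s.count true)) :
    {g : QF | g.IsZReduced ∧ FormEquiv f g}.ncard =
      ((Finset.range s.length).filter (fun i => E s i = false)).card := by
  obtain ⟨u, hu, hr⟩ := rep_of_sigma hf hsig
  have hR := ((riv_iff f).1 hf).1
  have hlen : 0 < s.length := List.length_pos_iff.2 hs.1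
  rw [caliber hf hlen (minPer_even hu hR hs hr hev)]
  simp only [letter hu hR hs.1 hr]

end ZCal

/-- **Corollary (Z-caliber).** For a primitive binary necklace of length `l` with
at least one 1: if the weight is odd, `l` equals the Z-caliber of the class
mapping to it; if the weight is even, `l` is the sum of the Z-calibers of the
two classes mapping to it. -/
theorem stmt8 (s : List Bool) (hprim : PrimitiveList s) (h1 : true ∈ s) :
    (Odd (s.count true) →
      ∀ (f : QF) (s' : List Bool), f.IsZReduced → IsPrimitiveForm f →
        f.IsSigma s' → (∃ n : ℕ, s'.rotate n = s) →
        s.length = {g : QF | g.IsZReduced ∧ FormEquiv f g}.ncard) ∧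
    (Even (s.count true) →
      ∀ (f₁ f₂ : QF) (s₁ s₂ : List Bool), f₁.IsZReduced → IsPrimitiveForm f₁ →
        f₂.IsZReduced → IsPrimitiveForm f₂ → f₁.IsSigma s₁ → f₂.IsSigma s₂ →
        (∃ n : ℕ, s₁.rotate n = s) → (∃ n : ℕ, s₂.rotate n = s) →
        ¬ FormEquiv f₁ f₂ →
        s.length = {g : QF | g.IsZReduced ∧ FormEquiv f₁ g}.ncard +
          {g : QF | g.IsZReduced ∧ FormEquiv f₂ g}.ncard) := by
  refine ⟨?_, ?_⟩
  · intro hodd f s' hf _ hsig hrot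
    obtain ⟨n, rfl⟩ := ZCal.rotate_symm hrot
    rw [← ZCal.caliber_odd hf (ZCal.prim_rotate hprim n) hsig (by rwa [ZCal.count_rotate]),
      List.length_rotate]
  · intro hev f₁ f₂ s₁ s₂ hf₁ hp₁ hf₂ hp₂ hs₁ hs₂ hr₁ hr₂ hne
    obtain ⟨n, rfl⟩ := hr₁
    obtain ⟨k, rfl⟩ := ZCal.rotate_symm hr₂
    rw [List.rotate_rotate] at hs₂
    generalize n + k = m at hs₂
    rw [List.length_rotate]
    rw [ZCal.count_rotate] at hev
    have hpr : PrimitiveList s₁ := by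
      obtain ⟨j, hj⟩ := ZCal.rotate_symm (s := s₁.rotate n) ⟨n, rfl⟩
      rw [hj]
      exact ZCal.prim_rotate hprim j
    obtain ⟨u, hu, hU⟩ := ZCal.rep_of_sigma hf₁ hs₁
    obtain ⟨w, hw, hW⟩ := ZCal.rep_of_sigma hf₂ hs₂
    have hR := ((ZCal.riv_iff f₁).1 hf₁).1
    have hit := ZCal.rep_iter hu hR hpr.1 hU m
    have hE : ZCal.E s₁ m = true := by
      by_contra hE
      rw [Bool.not_eq_true] at hE
      rw [hE] at hit
      simp only [ZCal.fl, Bool.false_eq_true, if_false] at hit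
      have e1 : FormEquiv f₁ (ZCal.nxt^[m] (ZCal.riv f₁)) :=
        ZCal.fe_trans (ZCal.fe_riv f₁) (ZCal.fe_iter _ m)
      have e := ZCal.eq_of_rep hu hw hit hW (ZCal.bez_fe e1 (ZCal.bez_of_prim hp₁))
        (ZCal.bez_fe (ZCal.fe_riv f₂) (ZCal.bez_of_prim hp₂))
      rw [e] at e1
      exact hne (ZCal.fe_trans e1 (ZCal.fe_symm (ZCal.fe_riv f₂)))
    rw [ZCal.caliber_even hf₁ hpr hs₁ hev,
      ZCal.caliber_even hf₂ (ZCal.prim_rotate hpr m) hs₂ (by rwa [ZCal.count_rotate]),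
      List.length_rotate]
    have hl : ZCal.E s₁ s₁.length = false := by
      rw [ZCal.E_length]; exact decide_eq_false (by simpa using hev)
    have hper : Function.Periodic (fun i => ZCal.E s₁ i = true) s₁.length := by
      intro i
      simp only
      rw [add_comm, ZCal.E_add_length, hl, Bool.xor_false]
    have h2 : ((Finset.range s₁.length).filter
        (fun i => ZCal.E (s₁.rotate m) i = false)).card =
        ((Finset.range s₁.length).filter (fun i => ZCal.E s₁ i = true)).card := by
      have h3 := Nat.filter_Ico_card_eq_of_periodic m s₁.length (fun i => ZCal.E s₁ i = true) hper
      rw [Nat.count_eq_card_filter_range] at h3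
      rw [← h3, Finset.card_filter, Finset.card_filter, Finset.sum_Ico_eq_sum_range]
      simp only [Nat.add_sub_cancel_left]
      apply Finset.sum_congr rfl
      intro i _
      rw [ZCal.E_rotate, hE]
      cases ZCal.E s₁ (m + i) <;> simp
    rw [h2]
    have h4 := Finset.card_filter_add_card_filter_not (s := Finset.range s₁.length)
      (fun i => ZCal.E s₁ i = false)
    simp only [Bool.not_eq_false, Finset.card_range] at h4
    exact h4.symm
end

section
/- If f is in G⁺ with γ(f) = (q₁,…,q_l), then μ(R_G(f)) = R_Z(μ(f)) and μ(R_G(R_G(f))) = R_Z^{q₂}(μ(f)), where R_Z^{q₂} denotes the q₂-fold iterate of the Zagier reduction operator. -/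
theorem s16_cont_pos : ∀ (L : List ℤ), (∀ q ∈ L, 0 < q) → 0 < cont L
  | [], _ => by simp [cont]
  | [q], h => by simpa [cont] using h
  | q :: r :: t, h => by
    have h1 := s16_cont_pos (r :: t) (fun y hy => h y (List.mem_cons_of_mem _ hy))
    have h2 := s16_cont_pos t
      (fun y hy => h y (List.mem_cons_of_mem _ (List.mem_cons_of_mem _ hy)))
    have h3 := h q (by simp)
    simp only [cont]
    positivity

theorem s16_cont_coprime : ∀ (L : List ℤ), IsCoprime (cont L) (cont L.tail)
  | [] => by simp [cont, isCoprime_one_left]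
  | [q] => by simp [cont, isCoprime_one_right]
  | q :: r :: t => by
    have h := s16_cont_coprime (r :: t)
    simp only [cont, List.tail_cons] at h ⊢
    have := h.symm.add_mul_left_left q
    rwa [add_comm, mul_comm (cont (r :: t))] at this

theorem s16_coprime_eq {a b c d : ℤ} (ha : 0 < a) (hc : 0 < c)
    (h1 : IsCoprime a b) (h2 : IsCoprime c d) (h : a * d = c * b) : a = c := by
  have e1 : a ∣ c := h1.dvd_of_dvd_mul_right ⟨d, h.symm⟩
  have e2 : c ∣ a := h2.dvd_of_dvd_mul_right ⟨b, h⟩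
  exact Int.dvd_antisymm ha.le hc.le e1 e2

theorem s16_core (x : ℝ) (hx : 1 < x) (q1 q2 : ℤ) (rest : List ℤ)
    (hpos : ∀ q ∈ q1 :: q2 :: rest, 0 < q) (b d : ℤ)
    (hdet : cont (q1 :: q2 :: rest) * d - cont (q2 :: rest) * b = (-1) ^ rest.length)
    (hbp : 0 < b) (hd0 : 0 ≤ d) (hd1 : d ≤ cont (q2 :: rest))
    (hfix : x * (cont (q2 :: rest) * x + d) = cont (q1 :: q2 :: rest) * x + b) :
    ∃ w : ℝ, (q2 : ℝ) ≤ w ∧ w < q2 + 1 ∧ (x - q1) * w = 1 := by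
  have hq2 : 0 < q2 := hpos q2 (by simp)
  obtain ⟨b', hb'⟩ : ∃ b', b' = b - q1 * d := ⟨_, rfl⟩
  have hb : b = b' + q1 * d := by linarith
  subst hb
  clear hb'
  have key : ∀ c e g : ℤ, cont (q2 :: rest) = c → cont rest = e → c = q2 * e + g →
      (0 : ℝ) < e * x + b' → (0 : ℝ) ≤ g * x + (d - q2 * b') →
      (0 : ℝ) < (e - g) * x + (b' - (d - q2 * b')) →
      ∃ w : ℝ, (q2 : ℝ) ≤ w ∧ w < q2 + 1 ∧ (x - q1) * w = 1 := by
    intro c e g hc he hceg h1 h2 h3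
    have ha : cont (q1 :: q2 :: rest) = q1 * c + e := by simp only [cont, hc, he]
    rw [ha, hc] at hfix
    push_cast at hfix
    have hcr : (c : ℝ) = q2 * e + g := by exact_mod_cast hceg
    refine ⟨(c * x + d) / (e * x + b'), ?_, ?_, ?_⟩
    · rw [le_div_iff₀ h1, hcr]; linarith
    · rw [div_lt_iff₀ h1, hcr]; linarith
    · rw [← mul_div_assoc, div_eq_one_iff_eq h1.ne']
      linarith
  rcases rest with _ | ⟨q3, s⟩
  · simp [cont] at hdet hd1
    have h1 : d - q2 * b' = 1 := by linarith
    have hb0 : b' = 0 := by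
      have : b' < 1 := by nlinarith
      have : -1 < b' := by
        by_contra hn
        have h2 : b' ≤ -1 := by omega
        have h3 : q2 * b' ≤ -1 := by nlinarith
        have h4 : d = 0 := by linarith
        rw [h4] at hbp
        linarith
      omega
    subst hb0
    have : d = 1 := by linarith
    subst this
    apply key q2 1 0 <;> simp [cont] <;> linarith
  · have he : 0 < cont (q3 :: s) := s16_cont_pos _ (fun y hy => hpos y (by simp_all))
    have hg : 0 < cont s := s16_cont_pos _ (fun y hy => hpos y (by simp_all))
    have hq3 : 0 < q3 := hpos q3 (by simp)
    have hge : cont s < cont (q3 :: s) ∨ (s = [] ∧ q3 = 1) := by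
      rcases s with _ | ⟨q4, s⟩
      · simp [cont]; omega
      · left
        have : 0 < cont s := s16_cont_pos _ (fun y hy => hpos y (by simp_all))
        simp only [cont] at hg ⊢
        nlinarith
    have hc : cont (q2 :: q3 :: s) = q2 * cont (q3 :: s) + cont s := by simp only [cont]
    have ha : cont (q1 :: q2 :: q3 :: s) = q1 * cont (q2 :: q3 :: s) + cont (q3 :: s) := by
      simp only [cont]
    have k := key _ _ (cont s) rfl rfl hc
    rw [ha] at hdet
    have hc2 : 2 ≤ cont (q2 :: q3 :: s) := by rw [hc]; nlinarith
    obtain ⟨ε, hε, hε1⟩ : ∃ ε : ℤ, (-1) ^ (q3 :: s).length = ε ∧ (ε = 1 ∨ ε = -1) :=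
      ⟨_, rfl, neg_one_pow_eq_or ℤ _⟩
    rw [hε] at hdet
    generalize hcc : cont (q2 :: q3 :: s) = c at *
    generalize hee : cont (q3 :: s) = e at *
    generalize hgg : cont s = g at *
    have e1 : e * d - c * b' = ε := by linarith
    have hb0 : 0 ≤ b' := by
      by_contra hneg
      have : b' ≤ -1 := by omega
      rcases hε1 with h | h <;> nlinarith
    obtain ⟨d', hd'⟩ : ∃ d', d' = d - q2 * b' := ⟨_, rfl⟩
    have e2 : e * d' = g * b' + ε := by rw [hd']; linear_combination e1 + b' * hc
    have hdm : -1 ≤ d' := by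
      by_contra hneg
      have : d' ≤ -2 := by omega
      rcases hε1 with h | h <;> nlinarith [mul_nonneg hg.le hb0]
    have hd'r : (d' : ℝ) = d - q2 * b' := by exact_mod_cast hd'
    rw [← hd'r] at k
    have heR : (1 : ℝ) ≤ e := by exact_mod_cast he
    have hgR : (1 : ℝ) ≤ g := by exact_mod_cast hg
    have hbR : (0 : ℝ) ≤ b' := by exact_mod_cast hb0
    have hdR : (-1 : ℝ) ≤ d' := by exact_mod_cast hdm
    apply k
    · nlinarith
    · nlinarith
    · rcases hge with hlt | ⟨rfl, rfl⟩
      · have hbd : -1 ≤ b' - d' := by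
          by_contra hneg
          have h2 : b' - d' ≤ -2 := by omega
          have h3 : 0 ≤ (e - g) * b' := mul_nonneg (by linarith) hb0
          have h4 : e * (b' - d') = (e - g) * b' - ε := by linear_combination -e2
          rcases hε1 with h | h <;> nlinarith
        have hbdR : (-1 : ℝ) ≤ b' - d' := by exact_mod_cast hbd
        have : (1 : ℝ) ≤ e - g := by exact_mod_cast (by omega : (1 : ℤ) ≤ e - g)
        nlinarith
      · simp [cont] at hee hgg hε
        subst hee hgg hε
        have h1 : b' ≥ 1 := by
          by_contra hneg
          have : b' = 0 := by omega
          subst this; linarith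
        have : (d' : ℝ) = b' - 1 := by exact_mod_cast (by linarith : d' = b' - 1)
        rw [this]; norm_num

/-- Zagier's quotient from integer inequalities. -/
theorem s16_RZ_eq (g : QF) (n : ℤ) (ha : 0 < g.a)
    (h1 : 2 * (g.a : ℝ) * (n - 1) - g.b < Real.sqrt (g.disc : ℝ))
    (h2 : Real.sqrt (g.disc : ℝ) ≤ 2 * (g.a : ℝ) * n - g.b) :
    RZ g = g.transform n 1 (-1) 0 := by
  have haR : (0 : ℝ) < g.a := by exact_mod_cast ha
  have : ⌈((g.b : ℝ) + Real.sqrt (g.disc : ℝ)) / (2 * (g.a : ℝ))⌉ = n := by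
    rw [Int.ceil_eq_iff]
    constructor
    · rw [lt_div_iff₀ (by positivity)]; linarith
    · rw [div_le_iff₀ (by positivity)]; linarith
  rw [RZ, this]

theorem s16_RZ_two (g : QF) (ha : 0 < g.a) (h1 : g.a - g.b + g.c < 0)
    (h2 : 0 ≤ 4 * g.a - 2 * g.b + g.c) :
    RZ g = g.transform 2 1 (-1) 0 := by
  have haR : (0 : ℝ) < g.a := by exact_mod_cast ha
  have h1R : (g.a - g.b + g.c : ℝ) < 0 := by exact_mod_cast h1
  have h2R : (0 : ℝ) ≤ 4 * g.a - 2 * g.b + g.c := by exact_mod_cast h2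
  apply s16_RZ_eq g 2 ha
  · apply Real.lt_sqrt_of_sq_lt
    simp only [QF.disc]; push_cast
    nlinarith
  · rw [Real.sqrt_le_iff]
    simp only [QF.disc]; push_cast
    constructor
    · linarith
    · nlinarith

/-- The forms occurring along the iteration. -/
def s16_g (A B C k : ℤ) : QF :=
  ⟨A * (k + 1) ^ 2 + B * (k + 1) + C, 2 * A * k * (k + 1) + B * (2 * k + 1) + 2 * C,
    A * k ^ 2 + B * k + C⟩

theorem s16_iter (A B C q : ℤ) (hA : A < 0) (hC : 0 < C)
    (hq : 0 ≤ A * q ^ 2 + B * q + C) (k : ℕ) (hk : (k : ℤ) + 1 ≤ q) :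
    RZ^[k] (s16_g A B C 0) = s16_g A B C k := by
  have hp : ∀ j : ℤ, 0 ≤ j → j ≤ q → 0 ≤ A * j ^ 2 + B * j + C ∧
      (j < q → 0 < A * j ^ 2 + B * j + C) := by
    intro j h0 h1
    have hid : q * (A * j ^ 2 + B * j + C) =
        j * (A * q ^ 2 + B * q + C) + (q - j) * C + (-A) * (j * q * (q - j)) := by ring
    have t1 : 0 ≤ j * (A * q ^ 2 + B * q + C) := mul_nonneg h0 hq
    have t3 : 0 ≤ (-A) * (j * q * (q - j)) :=
      mul_nonneg (by linarith) (mul_nonneg (mul_nonneg h0 (by linarith)) (by linarith))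
    have hlt : j < q → 0 < A * j ^ 2 + B * j + C := by
      intro h
      have t2 : 0 < (q - j) * C := mul_pos (by linarith) hC
      have : 0 < q := by linarith
      by_contra hn
      nlinarith
    refine ⟨?_, hlt⟩
    rcases h1.lt_or_eq with h | h
    · exact (hlt h).le
    · rw [h]; exact hq
  induction k with
  | zero => simp
  | succ k ih =>
    push_cast at hk
    rw [Function.iterate_succ_apply', ih (by linarith)]
    have hk0 : (0 : ℤ) ≤ k := by positivity
    rw [s16_RZ_two]
    · simp only [s16_g, QF.transform, QF.mk.injEq]
      push_cast
      refine ⟨by ring, by ring, by ring⟩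
    · simp only [s16_g]
      exact (hp (k + 1) (by linarith) (by linarith)).2 (by linarith)
    · simp only [s16_g]; ring_nf; linarith
    · simp only [s16_g]
      have := (hp (k + 2) (by linarith) (by linarith)).1
      nlinarith

set_option maxHeartbeats 2000000 in
theorem stmt16 (f : QF) (hf : f.IsGPlus) (L : List ℤ) (hL : f.IsGamma L) :
    mu (RG f) = RZ (mu f) ∧
    mu (RG (RG f)) = RZ^[(L.tail.headI).toNat] (mu f) := by
  obtain ⟨A, B, C⟩ := f
  obtain ⟨⟨⟨hD0, hDs⟩, hAC, hB⟩, hA⟩ := hf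
  simp only [QF.disc] at hD0 hDs hAC hB hA
  obtain ⟨hB1, hB2⟩ := abs_lt.mp hB
  have hC : C < 0 := by by_contra h; nlinarith
  have hB0 : 0 < B := lt_of_le_of_lt (abs_nonneg _) hB
  obtain ⟨s, hs⟩ : ∃ s : ℝ, s = Real.sqrt ((B ^ 2 - 4 * A * C : ℤ) : ℝ) := ⟨_, rfl⟩
  have hDR : (0 : ℝ) < ((B ^ 2 - 4 * A * C : ℤ) : ℝ) := by exact_mod_cast hD0
  have hs0 : 0 < s := by rw [hs]; exact Real.sqrt_pos.mpr hDR
  have hs2 : s ^ 2 = (B : ℝ) ^ 2 - 4 * A * C := by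
    rw [hs, Real.sq_sqrt hDR.le]; push_cast; ring
  have hsn : ∀ m : ℤ, s ≠ m := by
    intro m hm
    apply hDs
    refine ⟨m, ?_⟩
    rw [hm] at hs2
    have : m ^ 2 = B ^ 2 - 4 * A * C := by exact_mod_cast hs2
    rw [← this]; ring
  have hAR : (0 : ℝ) < A := by exact_mod_cast hA
  have hCR : (C : ℝ) < 0 := by exact_mod_cast hC
  have hB0R : (0 : ℝ) < B := by exact_mod_cast hB0
  have hB2R : (A : ℝ) + C < B := by exact_mod_cast hB2
  have hB1R : -(B : ℝ) < A + C := by exact_mod_cast hB1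
  obtain ⟨x, hxd⟩ : ∃ x : ℝ, x = (B + s) / (2 * A) := ⟨_, rfl⟩
  have hxs : 2 * A * x = B + s := by rw [hxd]; field_simp
  have hxq : A * x ^ 2 - B * x + C = 0 := by
    have h : 4 * A * (A * x ^ 2 - B * x + C) = 0 := by
      linear_combination (2 * A * x - B + s) * hxs + hs2
    rcases mul_eq_zero.mp h with h | h
    · linarith
    · exact h
  have hx1 : 1 < x := by
    by_contra h
    have h1 : 2 * A * x ≤ 2 * A := by nlinarith
    have h2 : s ≤ 2 * A - B := by linarith
    have h3 : s ^ 2 ≤ (2 * A - B) ^ 2 := pow_le_pow_left₀ hs0.le h2 2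
    nlinarith
  have hxn : ∀ m : ℤ, x ≠ m := by
    intro m hm
    apply hsn (2 * A * m - B)
    rw [hm] at hxs; push_cast; linarith
  obtain ⟨q, hq⟩ : ∃ q : ℤ, q = ⌊x⌋ := ⟨_, rfl⟩
  have hqx : (q : ℝ) < x := lt_of_le_of_ne (hq ▸ Int.floor_le x) (fun h => hxn q h.symm)
  have hxq1 : x < q + 1 := hq ▸ Int.lt_floor_add_one x
  have hq1 : 1 ≤ q := by rw [hq, Int.le_floor]; push_cast; exact hx1.le
  have hq1R : (1 : ℝ) ≤ q := by exact_mod_cast hq1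
  have hRG : RG ⟨A, B, C⟩ = ⟨A * q ^ 2 - B * q + C, 2 * A * q - B, A⟩ := by
    have : gaussDelta ⟨A, B, C⟩ = q := by
      simp only [gaussDelta, QF.disc, ← hs, abs_of_pos hAR, ← hxd, ← hq, Int.sign_eq_one_of_pos hA,
        one_mul]
    simp only [RG, this, QF.transform, QF.mk.injEq]
    refine ⟨by ring, by ring, by ring⟩
  obtain ⟨A', hA'⟩ : ∃ A' : ℤ, A' = A * q ^ 2 - B * q + C := ⟨_, rfl⟩
  obtain ⟨B', hB'⟩ : ∃ B' : ℤ, B' = 2 * A * q - B := ⟨_, rfl⟩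
  rw [← hA', ← hB'] at hRG
  have hA'R : (A' : ℝ) = A * q ^ 2 - B * q + C := by exact_mod_cast hA'
  have hB'R : (B' : ℝ) = 2 * A * q - B := by exact_mod_cast hB'
  have hfac : (A' : ℝ) * x = -(x - q) * (A * q * x - C) := by
    rw [hA'R]; linear_combination (q : ℝ) * hxq
  have hA'neg : A' < 0 := by
    have h1 : 0 < (x - q) * (A * q * x - C) := by
      apply mul_pos (by linarith)
      have : 0 < A * q * x := by positivity
      linarith
    have : (A' : ℝ) < 0 := by
      by_contra h
      have : 0 ≤ (A' : ℝ) * x := mul_nonneg (by linarith) (by linarith)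
      linarith
    exact_mod_cast this
  have hA'negR : (A' : ℝ) < 0 := by exact_mod_cast hA'neg
  have hdisc' : B' ^ 2 - 4 * A' * A = B ^ 2 - 4 * A * C := by rw [hA', hB']; ring
  have hmuRG : mu (RG ⟨A, B, C⟩) = s16_g A' B' A 0 := by
    rw [hRG]
    simp only [mu, s16_g, not_lt.mpr hA'neg.le, if_false, QF.mk.injEq]
    refine ⟨by ring, by ring, by ring⟩
  have hfirst : RZ (mu ⟨A, B, C⟩) = s16_g A' B' A 0 := by
    have hmu : mu ⟨A, B, C⟩ = ⟨A, 2 * A + B, A + B + C⟩ := by simp only [mu, hA, if_true]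
    have hd : (⟨A, 2 * A + B, A + B + C⟩ : QF).disc = B ^ 2 - 4 * A * C := by
      simp only [QF.disc]; ring
    rw [hmu, s16_RZ_eq _ (q + 2) hA]
    · simp only [s16_g, QF.transform, QF.mk.injEq, hA', hB']
      refine ⟨by ring, by ring, by ring⟩
    · rw [hd, ← hs]; push_cast; nlinarith
    · rw [hd, ← hs]; push_cast; nlinarith
  refine ⟨hmuRG.trans hfirst.symm, ?_⟩
  obtain ⟨w, hwd⟩ : ∃ w : ℝ, w = (B' + s) / (2 * -A') := ⟨_, rfl⟩
  have hws : 2 * (-A') * w = B' + s := by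
    have : (A' : ℝ) ≠ 0 := hA'negR.ne
    rw [hwd]; field_simp
  have hwx : (x - q) * w = 1 := by
    have h : (2 * A) * (2 * (-A')) * ((x - q) * w - 1) = 0 := by
      rw [hA'R] at hws ⊢
      rw [hB'R] at hws
      linear_combination (2 * A * x - 2 * A * q) * hws + (2 * A * q - B + s) * hxs + hs2
    rcases mul_eq_zero.mp h with h | h
    · exact absurd h (by apply mul_ne_zero <;> linarith)
    · linarith
  have hw1 : 1 < w := by
    by_contra h
    nlinarith
  obtain ⟨r, hr⟩ : ∃ r : ℤ, r = ⌊w⌋ := ⟨_, rfl⟩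
  have hrw : (r : ℝ) ≤ w := hr ▸ Int.floor_le w
  have hr1 : 1 ≤ r := by rw [hr, Int.le_floor]; push_cast; exact hw1.le
  have hr1R : (1 : ℝ) ≤ r := by exact_mod_cast hr1
  have hRG2 : RG ⟨A', B', A⟩ = ⟨A' * r ^ 2 + B' * r + A, -2 * A' * r - B', A'⟩ := by
    have : gaussDelta ⟨A', B', A⟩ = -r := by
      simp only [gaussDelta, QF.disc, hdisc', ← hs, abs_of_neg hA'negR, ← hwd, ← hr,
        Int.sign_eq_neg_one_of_neg hA'neg]
      ring
    simp only [RG, this, QF.transform, QF.mk.injEq]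
    refine ⟨by ring, by ring, by ring⟩
  have hwq : A' * w ^ 2 + B' * w + A = 0 := by
    have h : 4 * (A' : ℝ) * (A' * w ^ 2 + B' * w + A) = 0 := by
      have hd : (B' : ℝ) ^ 2 - 4 * A' * A = B ^ 2 - 4 * A * C := by exact_mod_cast hdisc'
      linear_combination (-(2 * A' * w + B' - s)) * hws + hs2 - hd
    rcases mul_eq_zero.mp h with h | h
    · linarith
    · exact h
  have hwn : w ≠ r := by
    intro h
    apply hsn (2 * (-A') * r - B')
    rw [h] at hws; push_cast; linarith
  have hpr : 0 < A' * r ^ 2 + B' * r + A := by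
    have hlt : (r : ℝ) < w := lt_of_le_of_ne hrw (Ne.symm hwn)
    have h : w * (A' * r ^ 2 + B' * r + A) = (w - r) * (A - A' * r * w) := by
      linear_combination (r : ℝ) * hwq
    have h2 : 0 < (w - r) * (A - A' * r * w) := by
      apply mul_pos (by linarith)
      have : 0 < (-A') * r * w := by
        apply mul_pos (mul_pos (by linarith) (by linarith)) (by linarith)
      linarith
    have h3 : (0 : ℝ) < A' * r ^ 2 + B' * r + A := by
      by_contra hn
      nlinarith
    exact_mod_cast h3
  have hmain : mu (RG (RG ⟨A, B, C⟩)) = RZ^[r.toNat] (mu ⟨A, B, C⟩) := by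
    obtain ⟨k, hk⟩ : ∃ k : ℕ, r = k + 1 := ⟨(r - 1).toNat, by omega⟩
    have : r.toNat = k + 1 := by omega
    rw [this, Function.iterate_succ_apply, hfirst,
      s16_iter A' B' A r hA'neg hA hpr.le k hk.symm.le, hRG, hRG2]
    simp only [mu, hpr, if_true, s16_g, QF.mk.injEq]
    rw [hk]
    refine ⟨by ring, by ring, by ring⟩
  obtain ⟨t, u, ⟨ht, hu, htu, -⟩, ⟨hLne, hLpos, hLcf⟩, hodd, heven⟩ := hL
  simp only [QF.disc] at htu hodd heven hLcf
  obtain ⟨ε, hε, hε1⟩ : ∃ ε : ℤ, t ^ 2 - (B ^ 2 - 4 * A * C) * u ^ 2 = 4 * ε ∧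
      (ε = 1 ∨ ε = -1) := by
    rcases (abs_eq (by norm_num)).mp htu with h | h
    · exact ⟨1, by linarith, Or.inl rfl⟩
    · exact ⟨-1, by linarith, Or.inr rfl⟩
  have hpar : Even (t - B * u) := by
    have h1 : Even ((t - B * u) * (t + B * u)) :=
      ⟨2 * (ε - A * C * u ^ 2), by linear_combination hε⟩
    rcases Int.even_mul.mp h1 with h | h
    · exact h
    · have : t - B * u = (t + B * u) - 2 * (B * u) := by ring
      rw [this]
      exact h.sub (even_two_mul _)
  obtain ⟨d, hd⟩ := hpar
  have ht' : t = B * u + 2 * d := by linarith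
  have hεd : d * (B * u + d) + A * C * u ^ 2 = ε := by
    rw [ht'] at hε; linarith
  obtain ⟨z, hz⟩ : ∃ z, z = B * u + d := ⟨_, rfl⟩
  have hACu : A * C * u ^ 2 ≤ -1 := by
    have : 0 < (-(A * C)) * u ^ 2 := mul_pos (by linarith) (by positivity)
    linarith
  have hBu : 0 < B * u := mul_pos hB0 hu
  have hAu : 0 < A * u := mul_pos hA hu
  have hd0 : 0 ≤ d := by
    by_contra hn
    have h1 : d ≤ -1 := by omega
    have h2 : (t + d) * d + A * C * u ^ 2 - 2 * d * d = ε := by rw [ht']; linarith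
    have h3 : t * d ≤ -1 := by nlinarith
    have h4 : 0 < d * d := by nlinarith
    have h5 : ε < -1 := by linarith
    omega
  have hzpos : 0 < z := by rw [hz]; linarith
  have hdA : d ≤ A * u := by
    by_contra hn
    have h1 : A * u + 1 ≤ d := by omega
    have h2 : 1 ≤ A + B + C := by linarith
    have h3 : (A * u + 1) * (B * u + (A * u + 1)) ≤ d * (B * u + d) := by
      apply mul_le_mul h1 (by linarith) (by linarith) hd0
    have h4 : 0 ≤ (A * u ^ 2) * (A + B + C - 1) := by
      apply mul_nonneg (by positivity) (by linarith)
    have h5 : 0 < A * u ^ 2 := by positivity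
    have h6 : 0 < A * u ^ 2 + B * u + 2 * (A * u) := by linarith
    have h7 : 1 < ε := by linarith
    omega
  have hT0 : 0 < cont L.tail := s16_cont_pos _ (fun y hy => hLpos y (List.mem_of_mem_tail hy))
  have hL0 : 0 < cont L := s16_cont_pos _ hLpos
  have hcross : cont L * (A * u) = z * cont L.tail := by
    have hz2 : (((t + B * u : ℤ) : ℚ) / 2) = z := by
      rw [hz, ht']; push_cast; ring
    rw [hz2] at hLcf
    have hne : ((A * u : ℤ) : ℚ) ≠ 0 := by exact_mod_cast hAu.ne'
    field_simp at hLcf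
    exact_mod_cast hLcf
  have hcop : IsCoprime z (A * u) := by
    have hdet : z * d + (A * u) * (C * u) = ε := by rw [hz]; linarith
    refine ⟨ε * d, ε * (C * u), ?_⟩
    have : ε * ε = 1 := by rcases hε1 with h | h <;> rw [h] <;> norm_num
    linear_combination ε * hdet + this
  have hLz : cont L = z := s16_coprime_eq hL0 hzpos (s16_cont_coprime L) hcop hcross
  have hLA : cont L.tail = A * u := by
    rw [hLz] at hcross
    exact (mul_left_cancel₀ hzpos.ne' hcross).symm
  have hlen : (-1 : ℤ) ^ L.length = ε := by
    rcases hε1 with h | h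
    · rw [h]; exact (heven (by rw [hε, h]; norm_num)).neg_one_pow
    · rw [h]; exact (hodd (by rw [hε, h]; norm_num)).neg_one_pow
  rcases L with _ | ⟨q1, _ | ⟨q2, rest⟩⟩
  · exact absurd rfl hLne
  ·
    simp [cont] at hLz hLA hlen
    have hA1 : A = 1 := by
      have := Int.eq_one_or_neg_one_of_mul_eq_one hLA.symm
      omega
    have hu1 : u = 1 := by rw [hA1] at hLA; linarith
    subst hA1 hu1
    subst hlen
    have hd00 : d = 0 := by
      by_contra hn
      have : d = 1 := by omega
      subst this
      linarith
    subst hd00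
    have hC1 : C = -1 := by linarith
    subst hC1
    have hqB : q = B := by
      rw [hq, Int.floor_eq_iff]
      push_cast at hxq
      constructor
      · by_contra hn
        nlinarith
      · by_contra hn
        nlinarith
    have ea : A' = -1 := by rw [hA', hqB]; ring
    have eb : B' = B := by rw [hB', hqB]; ring
    have hwx' : w = x := by
      rw [hwd, hxd, ea, eb]; norm_num
    have hrB : r = B := by rw [hr, hwx', ← hq, hqB]
    simp only [List.tail_cons, List.headI_nil]
    have : RG (RG ⟨1, B, -1⟩) = ⟨1, B, -1⟩ := by
      rw [hRG, hRG2, ea, eb, hrB]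
      simp only [QF.mk.injEq]
      exact ⟨by ring, by ring, trivial⟩
    rw [this]
    rfl
  · simp only [List.tail_cons, List.headI_cons] at hLA ⊢
    obtain ⟨w', h1, h2, h3⟩ := s16_core x hx1 q1 q2 rest hLpos (-(C * u)) d
      (by
        rw [hLz, hLA]
        simp only [List.length_cons] at hlen
        rw [pow_succ, pow_succ] at hlen
        rw [hz]; linarith)
      (by have := mul_pos_of_neg_of_neg hC (neg_lt_zero.mpr hu); linarith) hd0 (by rw [hLA]; exact hdA)
      (by
        rw [hLz, hLA, hz]; push_cast
        linear_combination (u : ℝ) * hxq)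
    have hq2 : 0 < q2 := hLpos q2 (by simp)
    have hq2R : (1 : ℝ) ≤ q2 := by exact_mod_cast hq2
    have hw'1 : 1 ≤ w' := by linarith
    have hqq : q = q1 := by
      rw [hq, Int.floor_eq_iff]
      constructor
      · by_contra hn
        nlinarith
      · apply lt_of_le_of_ne
        · by_contra hn
          nlinarith
        · have := hxn (q1 + 1)
          push_cast at this
          exact this
    have hww : w = w' := by
      rw [hqq] at hwx
      have hne : x - q1 ≠ 0 := by
        intro h; rw [h] at hwx; linarith
      exact mul_left_cancel₀ hne (hwx.trans h3.symm)
    have hrq : r = q2 := by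
      rw [hr, Int.floor_eq_iff, hww]
      exact ⟨h1, h2⟩
    rw [← hrq]
    exact hmain
end
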